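/- Let n ≥ 1, s ≥ 1, and let a ∈ ℂ^n be an isotropic point (a·a = 0). Set f = q_n^{[s]} − (a·x)^{[2s]}, where q_n^{[s]} = q_n^s/(2^s s!) and (a·x)^{[2s]} = (a·x)^{2s}/(2s)!. Then the middle catalecticant map Cat_{f,s} is injective, i.e., it has full rank T_{n,s} = binom(s+n−1, s). -/

import Mathlib

open MvPolynomial

noncomputable def qpoly (n : ℕ) : MvPolynomial (Fin n) ℂ :=
  ∑ i : Fin n, X i ^ 2

noncomputable def linForm {n : ℕ} (a : Fin n → ℂ) : MvPolynomial (Fin n) ℂ :=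
  ∑ i : Fin n, C (a i) * X i

noncomputable def dotC {n : ℕ} (a b : Fin n → ℂ) : ℂ :=
  ∑ i : Fin n, a i * b i

noncomputable def diffOp {n : ℕ} (φ f : MvPolynomial (Fin n) ℂ) : MvPolynomial (Fin n) ℂ :=
  ∑ d ∈ φ.support, φ.coeff d •
    ((List.ofFn fun i : Fin n =>
        ((pderiv i).toLinearMap : MvPolynomial (Fin n) ℂ →ₗ[ℂ] MvPolynomial (Fin n) ℂ) ^ d i).prod f)

noncomputable def lap {n : ℕ} (f : MvPolynomial (Fin n) ℂ) : MvPolynomial (Fin n) ℂ :=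
  ∑ i : Fin n, pderiv i (pderiv i f)

noncomputable def catRank (n j : ℕ) (f : MvPolynomial (Fin n) ℂ) : ℕ :=
  Module.finrank ℂ
    (Submodule.span ℂ ((fun φ => diffOp φ f) '' {φ : MvPolynomial (Fin n) ℂ | φ.IsHomogeneous j}))

/-- Induction on exponent vectors by adding one variable at a time. -/
theorem exponent_induction {n : ℕ} {P : (Fin n →₀ ℕ) → Prop} (zero : P 0)
    (add_single : ∀ i d, P d → P (Finsupp.single i 1 + d)) (d : Fin n →₀ ℕ) : P d := by
  induction d using Finsupp.induction with
  | zero => exact zero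
  | single_add i b d _ _ ih =>
    clear * - ih add_single
    induction b with
    | zero => simpa using ih
    | succ b ihb =>
      rw [add_comm b 1, Finsupp.single_add, add_assoc]
      exact add_single i _ ihb

/-- Induction for homogeneous polynomials by multiplying with one variable at a time. -/
theorem homogeneous_induction {n : ℕ} {P : ℕ → MvPolynomial (Fin n) ℂ → Prop}
    (zero : ∀ k, P k 0) (add : ∀ k φ ψ, P k φ → P k ψ → P k (φ + ψ))
    (smul : ∀ k (c : ℂ) φ, P k φ → P k (c • φ)) (one : P 0 1)
    (X_mul : ∀ i k φ, P k φ → P (k + 1) (X i * φ))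
    {k : ℕ} {φ : MvPolynomial (Fin n) ℂ} (hφ : φ.IsHomogeneous k) : P k φ := by
  have mono : ∀ d : Fin n →₀ ℕ, P d.degree (monomial d 1) := by
    intro d
    induction d using exponent_induction with
    | zero => simpa using one
    | add_single i d ih =>
      have h : (monomial (Finsupp.single i 1 + d) 1 : MvPolynomial (Fin n) ℂ) =
          X i * monomial d 1 := by
        rw [X, monomial_mul, one_mul]
      rw [h, map_add, Finsupp.degree_single, add_comm]
      exact X_mul i _ _ ih
  rw [φ.as_sum]
  refine Finset.sum_induction _ (P k) (add k) (zero k) fun d hd => ?_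
  have hdeg : d.degree = k := by
    by_contra h
    exact (mem_support_iff.mp hd) (hφ.coeff_eq_zero h)
  have h : (monomial d (coeff d φ) : MvPolynomial (Fin n) ℂ) = coeff d φ • monomial d 1 := by
    rw [smul_monomial, smul_eq_mul, mul_one]
  rw [h, ← hdeg]
  exact smul _ _ _ (mono d)

theorem pderiv_commute {n : ℕ} (i j : Fin n) (f : MvPolynomial (Fin n) ℂ) :
    pderiv i (pderiv j f) = pderiv j (pderiv i f) := by
  ext d
  simp only [coeff_pderiv, Finsupp.add_apply]
  rw [add_right_comm]
  rcases eq_or_ne i j with rfl | h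
  · ring
  · simp only [Finsupp.single_eq_of_ne h, Finsupp.single_eq_of_ne h.symm]
    push_cast
    ring

/-- The algebra homomorphism sending `X i` to `∂/∂X i` computes the apolarity action. -/
theorem exists_diffHom (n : ℕ) :
    ∃ D : MvPolynomial (Fin n) ℂ →ₐ[ℂ] Module.End ℂ (MvPolynomial (Fin n) ℂ),
      (∀ i f, D (X i) f = pderiv i f) ∧ ∀ φ f, diffOp φ f = D φ f := by
  let p : Fin n → Module.End ℂ (MvPolynomial (Fin n) ℂ) := fun i => (pderiv i).toLinearMap
  let A := Algebra.adjoin ℂ (Set.range p)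
  have hcomm : ∀ x ∈ Set.range p, ∀ y ∈ Set.range p, x * y = y * x := by
    rintro _ ⟨i, rfl⟩ _ ⟨j, rfl⟩
    exact LinearMap.ext fun f => pderiv_commute i j f
  have := Algebra.isMulCommutative_adjoin ℂ hcomm
  let _ : CommRing A := { mul_comm := fun x y => mul_comm' x y }
  let u : Fin n → A := fun i => ⟨p i, Algebra.subset_adjoin ⟨i, rfl⟩⟩
  refine ⟨A.val.comp (aeval u), fun i f => by simp [u, p], fun φ f => ?_⟩
  have hop : ∀ d : Fin n →₀ ℕ,
      (List.ofFn fun i => p i ^ d i).prod = A.val (∏ i, u i ^ d i) := by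
    intro d
    rw [← List.prod_ofFn, map_list_prod, List.map_ofFn]
    congr 1
  simp only [diffOp, AlgHom.comp_apply, aeval_def, eval₂_eq', map_sum, map_mul]
  rw [LinearMap.sum_apply]
  refine Finset.sum_congr rfl fun d _ => ?_
  rw [AlgHom.commutes, ← hop, ← Algebra.smul_def, LinearMap.smul_apply]

section

variable {n : ℕ} {D : MvPolynomial (Fin n) ℂ →ₐ[ℂ] Module.End ℂ (MvPolynomial (Fin n) ℂ)}

theorem diffHom_monomial_coeff_zero (hD : ∀ i f, D (X i) f = pderiv i f) (d : Fin n →₀ ℕ) :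
    ∀ f, coeff 0 (D (monomial d 1) f) = (∏ i, (d i).factorial : ℕ) * coeff d f := by
  induction d using exponent_induction with
  | zero => intro f; simp
  | add_single i d ih =>
    intro f
    have h : (monomial (Finsupp.single i 1 + d) 1 : MvPolynomial (Fin n) ℂ) =
        monomial d 1 * X i := by
      rw [X, monomial_mul, one_mul, add_comm]
    rw [h, map_mul, Module.End.mul_apply, hD, ih, coeff_pderiv, add_comm (Finsupp.single i 1)]
    have h2 : (∏ j, ((d + Finsupp.single i 1 : Fin n →₀ ℕ) j).factorial) =
        (∏ j, (d j).factorial) * (d i + 1) := by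
      rw [← Finset.mul_prod_erase _ _ (Finset.mem_univ i),
        ← Finset.mul_prod_erase _ (fun j => (d j).factorial) (Finset.mem_univ i)]
      rw [Finset.prod_congr rfl (g := fun j => (d j).factorial)]
      · simp [Nat.factorial_succ]; ring
      · intro j hj
        simp [Finsupp.single_eq_of_ne (Finset.ne_of_mem_erase hj)]
    rw [h2]
    push_cast
    ring

theorem diffHom_coeff_zero (hD : ∀ i f, D (X i) f = pderiv i f)
    (φ f : MvPolynomial (Fin n) ℂ) : coeff 0 (D φ f) =
      ∑ d ∈ φ.support, coeff d φ * ((∏ i, (d i).factorial : ℕ) * coeff d f) := by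
  conv_lhs => rw [φ.as_sum]
  rw [map_sum, LinearMap.sum_apply, coeff_sum]
  refine Finset.sum_congr rfl fun d _ => ?_
  have h : (monomial d (coeff d φ) : MvPolynomial (Fin n) ℂ) = coeff d φ • monomial d 1 := by
    rw [smul_monomial, smul_eq_mul, mul_one]
  rw [h, map_smul, LinearMap.smul_apply, coeff_smul, diffHom_monomial_coeff_zero hD, smul_eq_mul]

theorem diffHom_coeff_zero_comm (hD : ∀ i f, D (X i) f = pderiv i f)
    (φ f : MvPolynomial (Fin n) ℂ) : coeff 0 (D φ f) = coeff 0 (D f φ) := by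
  rw [diffHom_coeff_zero hD, diffHom_coeff_zero hD,
    Finset.sum_subset (Finset.subset_union_left (s₂ := f.support)),
    Finset.sum_subset (Finset.subset_union_right (s₁ := φ.support) (s₂ := f.support))]
  · exact Finset.sum_congr rfl fun d _ => by ring
  · intro d _ hd; simp [notMem_support_iff.mp hd]
  · intro d _ hd; simp [notMem_support_iff.mp hd]

theorem fischer_self (hD : ∀ i f, D (X i) f = pderiv i f) (f : MvPolynomial (Fin n) ℂ) :
    coeff 0 (D (map (starRingEnd ℂ) f) f) =
      ((∑ d ∈ f.support, ((∏ i, (d i).factorial : ℕ) : ℝ) * Complex.normSq (coeff d f) : ℝ) : ℂ) := by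
  rw [diffHom_coeff_zero_comm hD, diffHom_coeff_zero hD]
  push_cast
  refine Finset.sum_congr rfl fun d _ => ?_
  rw [coeff_map, Complex.normSq_eq_conj_mul_self]
  ring

theorem fischer_self_nonneg (hD : ∀ i f, D (X i) f = pderiv i f) (f : MvPolynomial (Fin n) ℂ) :
    0 ≤ (coeff 0 (D (map (starRingEnd ℂ) f) f)).re := by
  rw [fischer_self hD, Complex.ofReal_re]
  exact Finset.sum_nonneg fun d _ => mul_nonneg (Nat.cast_nonneg _) (Complex.normSq_nonneg _)

theorem eq_zero_of_fischer_self_nonpos (hD : ∀ i f, D (X i) f = pderiv i f)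
    (f : MvPolynomial (Fin n) ℂ) (h : (coeff 0 (D (map (starRingEnd ℂ) f) f)).re ≤ 0) :
    f = 0 := by
  rw [fischer_self hD, Complex.ofReal_re] at h
  by_contra hf
  refine absurd h (not_le.mpr (Finset.sum_pos (fun d hd => mul_pos ?_ ?_) (support_nonempty.mpr hf)))
  · exact Nat.cast_pos.mpr (Finset.prod_pos fun i _ => Nat.factorial_pos _)
  · exact Complex.normSq_pos.mpr (mem_support_iff.mp hd)

theorem diffHom_qpoly (hD : ∀ i f, D (X i) f = pderiv i f) (f : MvPolynomial (Fin n) ℂ) :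
    D (qpoly n) f = ∑ i, pderiv i (pderiv i f) := by
  rw [qpoly, map_sum, LinearMap.sum_apply]
  exact Finset.sum_congr rfl fun i _ => by rw [pow_two, map_mul, Module.End.mul_apply, hD, hD]

theorem map_conj_diffHom_qpoly_pow (hD : ∀ i f, D (X i) f = pderiv i f) (j : ℕ)
    (f : MvPolynomial (Fin n) ℂ) :
    map (starRingEnd ℂ) (D (qpoly n ^ j) f) = D (qpoly n ^ j) (map (starRingEnd ℂ) f) := by
  induction j generalizing f with
  | zero => simp
  | succ j ih =>
    rw [pow_succ, map_mul, Module.End.mul_apply, Module.End.mul_apply, ih]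
    congr 1
    simp only [diffHom_qpoly hD, map_sum, pderiv_map]

/-- Multiplication by `q` is adjoint to the Laplacian for the Fischer inner product. -/
theorem fischer_qpoly_pow_mul (hD : ∀ i f, D (X i) f = pderiv i f) (j : ℕ)
    (φ : MvPolynomial (Fin n) ℂ) :
    coeff 0 (D (map (starRingEnd ℂ) φ) (qpoly n ^ j * D (qpoly n ^ j) φ)) =
      coeff 0 (D (map (starRingEnd ℂ) (D (qpoly n ^ j) φ)) (D (qpoly n ^ j) φ)) := by
  rw [diffHom_coeff_zero_comm hD, mul_comm, map_mul, Module.End.mul_apply,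
    ← map_conj_diffHom_qpoly_pow hD, diffHom_coeff_zero_comm hD]

theorem diffHom_qpoly_X_mul (hD : ∀ i f, D (X i) f = pderiv i f) (i : Fin n)
    (f : MvPolynomial (Fin n) ℂ) :
    D (qpoly n) (X i * f) = X i * D (qpoly n) f + (2 : ℂ) • pderiv i f := by
  simp only [diffHom_qpoly hD, pderiv_mul, map_add, Finset.mul_sum, Finset.sum_add_distrib]
  have h1 : ∀ x : Fin n, pderiv x (pderiv x (X i : MvPolynomial (Fin n) ℂ)) = 0 := by
    intro x
    rcases eq_or_ne i x with rfl | h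
    · rw [pderiv_X_self, pderiv_one]
    · rw [pderiv_X_of_ne h, map_zero]
  have h2 : ∑ x, pderiv x (X i : MvPolynomial (Fin n) ℂ) * pderiv x f = pderiv i f := by
    rw [Finset.sum_eq_single i]
    · simp
    · intro j _ hj; rw [pderiv_X_of_ne hj.symm, zero_mul]
    · simp
  simp only [h1, h2, zero_mul, Finset.sum_const_zero, two_smul]
  ring

theorem diffHom_pderiv_comm (hD : ∀ i f, D (X i) f = pderiv i f) (φ : MvPolynomial (Fin n) ℂ)
    (i : Fin n) (f : MvPolynomial (Fin n) ℂ) : D φ (pderiv i f) = pderiv i (D φ f) := by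
  rw [← hD, ← hD, ← Module.End.mul_apply, ← Module.End.mul_apply, ← map_mul, ← map_mul, mul_comm]

theorem diffHom_qpoly_pow_X_mul (hD : ∀ i f, D (X i) f = pderiv i f) (i : Fin n) (j : ℕ)
    (f : MvPolynomial (Fin n) ℂ) :
    D (qpoly n ^ (j + 1)) (X i * f) =
      X i * D (qpoly n ^ (j + 1)) f + (2 * (j + 1) : ℂ) • pderiv i (D (qpoly n ^ j) f) := by
  induction j with
  | zero => simp [diffHom_qpoly_X_mul hD]
  | succ j ih =>
    rw [pow_succ', map_mul D, Module.End.mul_apply, ih, map_add, diffHom_qpoly_X_mul hD, map_smul,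
      diffHom_pderiv_comm hD, ← Module.End.mul_apply, ← Module.End.mul_apply, ← map_mul,
      ← map_mul, ← pow_succ', ← pow_succ', add_assoc, ← add_smul]
    congr 2
    push_cast
    ring

/-- The divided power `q_n^{[m]}`. -/
noncomputable def qdiv (n m : ℕ) : MvPolynomial (Fin n) ℂ :=
  ((2 : ℂ) ^ m * (Nat.factorial m : ℂ))⁻¹ • qpoly n ^ m

theorem two_mul_succ_mul_inv (m : ℕ) :
    ((2 : ℂ) ^ (m + 1) * ((m + 1).factorial : ℂ))⁻¹ * (2 * (m + 1)) =
      ((2 : ℂ) ^ m * (m.factorial : ℂ))⁻¹ := by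
  have h1 : (m.factorial : ℂ) ≠ 0 := Nat.cast_ne_zero.mpr (Nat.factorial_ne_zero m)
  have h2 : (m : ℂ) + 1 ≠ 0 := Nat.cast_add_one_ne_zero m
  rw [Nat.factorial_succ]
  push_cast
  field_simp
  ring

theorem pderiv_qpoly (i : Fin n) : pderiv i (qpoly n) = C 2 * X i := by
  rw [qpoly, map_sum, Finset.sum_eq_single i]
  · simp [map_ofNat]
  · intro j _ hj; rw [pderiv_pow, pderiv_X_of_ne hj, mul_zero]
  · simp

theorem pderiv_qdiv_succ (i : Fin n) (m : ℕ) : pderiv i (qdiv n (m + 1)) = X i * qdiv n m := by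
  rw [qdiv, Derivation.map_smul, pderiv_pow, pderiv_qpoly, qdiv, ← two_mul_succ_mul_inv m, mul_smul_comm,
    mul_smul]
  congr 1
  rw [smul_eq_C_mul]
  simp
  ring

theorem diffHom_qdiv_succ_X_mul (hD : ∀ i f, D (X i) f = pderiv i f) (i : Fin n) (j : ℕ)
    (f : MvPolynomial (Fin n) ℂ) :
    D (qdiv n (j + 1)) (X i * f) =
      X i * D (qdiv n (j + 1)) f + pderiv i (D (qdiv n j) f) := by
  simp only [qdiv, map_smul, LinearMap.smul_apply, Derivation.map_smul]
  rw [diffHom_qpoly_pow_X_mul hD, smul_add, smul_smul, two_mul_succ_mul_inv, mul_smul_comm]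

theorem diffHom_qdiv (hD : ∀ i f, D (X i) f = pderiv i f) {k : ℕ} {φ : MvPolynomial (Fin n) ℂ}
    (hφ : φ.IsHomogeneous k) :
    D (qpoly n ^ (k + 1)) φ = 0 ∧ ∀ m, D φ (qdiv n (m + k)) =
      ∑ j ∈ Finset.range (k + 1), qdiv n (m + j) * D (qdiv n j) φ := by
  refine homogeneous_induction (P := fun k φ => D (qpoly n ^ (k + 1)) φ = 0 ∧
    ∀ m, D φ (qdiv n (m + k)) = ∑ j ∈ Finset.range (k + 1), qdiv n (m + j) * D (qdiv n j) φ)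
    ?zero ?add ?smul ?one ?X_mul hφ
  case zero => simp
  case add =>
    intro k φ ψ h1 h2
    refine ⟨by rw [map_add, h1.1, h2.1, add_zero], fun m => ?_⟩
    simp only [map_add, LinearMap.add_apply, h1.2, h2.2, mul_add, Finset.sum_add_distrib]
  case smul =>
    intro k c φ h
    refine ⟨by rw [map_smul, h.1, smul_zero], fun m => ?_⟩
    simp only [map_smul, LinearMap.smul_apply, h.2, mul_smul_comm, Finset.smul_sum]
  case one =>
    constructor
    · simp only [zero_add, pow_one, diffHom_qpoly hD, pderiv_one, map_zero, Finset.sum_const_zero]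
    · intro m
      simp [qdiv]
  case X_mul =>
    rintro i k φ ⟨h0, h⟩
    have h0' : D (qpoly n ^ (k + 1 + 1)) φ = 0 := by
      rw [pow_succ', map_mul, Module.End.mul_apply, h0, map_zero]
    refine ⟨by rw [diffHom_qpoly_pow_X_mul hD, h0, h0']; simp, fun m => ?_⟩
    have hq0 : D (qdiv n (k + 1)) φ = 0 := by
      rw [qdiv, map_smul, LinearMap.smul_apply, h0, smul_zero]
    have hE : ∀ f : MvPolynomial (Fin n) ℂ, D (qdiv n 0) f = f := by intro f; simp [qdiv]
    have hs : m + (k + 1) = m + 1 + k := by ring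
    rw [map_mul, Module.End.mul_apply, hD, hs, h, map_sum]
    conv_rhs => rw [Finset.sum_range_succ']
    simp only [diffHom_qdiv_succ_X_mul hD, mul_add, Finset.sum_add_distrib, pderiv_mul, hE]
    have e1 : ∑ j ∈ Finset.range (k + 1), pderiv i (qdiv n (m + 1 + j)) * D (qdiv n j) φ =
        ∑ j ∈ Finset.range (k + 1), qdiv n (m + (j + 1)) * (X i * D (qdiv n (j + 1)) φ) +
          qdiv n (m + 0) * (X i * φ) := by
      have := Finset.sum_range_succ' (fun j => qdiv n (m + j) * (X i * D (qdiv n j) φ)) (k + 1)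
      rw [hE] at this
      rw [← this]
      conv_rhs => rw [Finset.sum_range_succ, hq0, mul_zero, mul_zero, add_zero]
      refine Finset.sum_congr rfl fun j _ => ?_
      rw [add_right_comm, pderiv_qdiv_succ]
      ring
    rw [e1]
    simp only [add_right_comm m 1, add_assoc m]
    ring

/-- The middle catalecticant of `q_n^{[s]}` is injective. -/
theorem eq_zero_of_diffHom_qdiv_eq_zero (hD : ∀ i f, D (X i) f = pderiv i f) {s : ℕ}
    {φ : MvPolynomial (Fin n) ℂ} (hφ : φ.IsHomogeneous s) (h : D φ (qdiv n s) = 0) : φ = 0 := by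
  have h1 := (diffHom_qdiv hD hφ).2 0
  simp only [zero_add] at h1
  rw [h] at h1
  let c : ℕ → ℝ := fun j => ((2 : ℝ) ^ j * (j.factorial : ℝ))⁻¹ ^ 2
  have h2 : ∑ j ∈ Finset.range (s + 1),
      c j * (coeff 0 (D (map (starRingEnd ℂ) (D (qpoly n ^ j) φ)) (D (qpoly n ^ j) φ))).re = 0 := by
    have h3 := congrArg (fun g => (coeff 0 (D (map (starRingEnd ℂ) φ) g)).re) h1
    simp only [map_zero, coeff_zero, Complex.zero_re, map_sum, coeff_sum, Complex.re_sum] at h3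
    rw [h3]
    refine Finset.sum_congr rfl fun j _ => ?_
    rw [← fischer_qpoly_pow_mul hD, ← Complex.re_ofReal_mul, ← smul_eq_mul, ← coeff_smul,
      ← map_smul]
    congr 3
    simp only [qdiv, map_smul, LinearMap.smul_apply, smul_mul_smul_comm, c]
    congr 1
    push_cast
    ring
  apply eq_zero_of_fischer_self_nonpos hD
  rw [Finset.sum_range_succ'] at h2
  have h4 : 0 ≤ ∑ j ∈ Finset.range s, c (j + 1) *
      (coeff 0 (D (map (starRingEnd ℂ) (D (qpoly n ^ (j + 1)) φ)) (D (qpoly n ^ (j + 1)) φ))).re :=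
    Finset.sum_nonneg fun j _ => mul_nonneg (by positivity) (fischer_self_nonneg hD _)
  have h5 : c 0 = 1 := by simp [c]
  simp only [h5, pow_zero, map_one, Module.End.one_apply, one_mul] at h2
  linarith

theorem pderiv_linForm (a : Fin n → ℂ) (i : Fin n) : pderiv i (linForm a) = C (a i) := by
  rw [linForm, map_sum, Finset.sum_eq_single i]
  · simp
  · intro j _ hj; rw [pderiv_C_mul, pderiv_X_of_ne hj, mul_zero]
  · simp

/-- The divided power `(a·x)^{[m]}`. -/
noncomputable def linDiv (a : Fin n → ℂ) (m : ℕ) : MvPolynomial (Fin n) ℂ :=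
  ((Nat.factorial m : ℂ))⁻¹ • linForm a ^ m

theorem pderiv_linDiv_succ (a : Fin n → ℂ) (i : Fin n) (m : ℕ) :
    pderiv i (linDiv a (m + 1)) = a i • linDiv a m := by
  have h1 : (m.factorial : ℂ) ≠ 0 := Nat.cast_ne_zero.mpr (Nat.factorial_ne_zero m)
  have h2 : (m : ℂ) + 1 ≠ 0 := Nat.cast_add_one_ne_zero m
  have h3 : ((m.factorial : ℂ))⁻¹ = (((m + 1).factorial : ℂ))⁻¹ * (m + 1) := by
    rw [Nat.factorial_succ]
    push_cast
    field_simp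
  rw [linDiv, Derivation.map_smul, pderiv_pow, pderiv_linForm, linDiv, h3, smul_comm, mul_smul]
  congr 1
  simp [smul_eq_C_mul]
  ring

theorem diffHom_linDiv (hD : ∀ i f, D (X i) f = pderiv i f) (a : Fin n → ℂ) {k : ℕ}
    {φ : MvPolynomial (Fin n) ℂ} (hφ : φ.IsHomogeneous k) :
    ∀ m, D φ (linDiv a (m + k)) = eval a φ • linDiv a m := by
  refine homogeneous_induction
    (P := fun k φ => ∀ m, D φ (linDiv a (m + k)) = eval a φ • linDiv a m)
    ?zero ?add ?smul ?one ?X_mul hφ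
  case zero => simp
  case add =>
    intro k φ ψ h1 h2 m
    simp only [map_add, LinearMap.add_apply, h1, h2, add_smul]
  case smul =>
    intro k c φ h m
    rw [map_smul, LinearMap.smul_apply, h, smul_eval, mul_smul]
  case one => simp
  case X_mul =>
    intro i k φ h m
    rw [mul_comm, map_mul, Module.End.mul_apply, hD, ← add_assoc, pderiv_linDiv_succ, map_smul, h,
      smul_smul, map_mul, eval_X, mul_comm]

theorem isHomogeneous_linForm (a : Fin n → ℂ) : (linForm a).IsHomogeneous 1 :=
  IsHomogeneous.sum _ _ _ fun _ _ => isHomogeneous_C_mul_X _ _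

theorem eval_linForm (a b : Fin n → ℂ) : eval b (linForm a) = dotC a b := by
  simp [linForm, dotC]

theorem diffHom_linForm (hD : ∀ i f, D (X i) f = pderiv i f) (a : Fin n → ℂ)
    (f : MvPolynomial (Fin n) ℂ) : D (linForm a) f = ∑ i, a i • pderiv i f := by
  simp only [linForm, map_sum, LinearMap.sum_apply, ← smul_eq_C_mul, map_smul,
    LinearMap.smul_apply, hD]

theorem diffHom_linForm_mul (hD : ∀ i f, D (X i) f = pderiv i f) (a : Fin n → ℂ)
    (f g : MvPolynomial (Fin n) ℂ) :
    D (linForm a) (f * g) = D (linForm a) f * g + f * D (linForm a) g := by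
  simp only [diffHom_linForm hD, pderiv_mul, smul_add, Finset.sum_add_distrib, Finset.sum_mul,
    Finset.mul_sum, smul_mul_assoc, mul_smul_comm]

theorem diffHom_linForm_linForm_pow (hD : ∀ i f, D (X i) f = pderiv i f) {a : Fin n → ℂ}
    (ha : dotC a a = 0) (k : ℕ) : D (linForm a) (linForm a ^ k) = 0 := by
  have h : ∑ i, a i • (C (a i) : MvPolynomial (Fin n) ℂ) = C (dotC a a) := by
    simp [dotC, smul_eq_C_mul]
  induction k with
  | zero => simp [diffHom_linForm hD]
  | succ k ih =>
    rw [pow_succ, diffHom_linForm_mul hD, ih, diffHom_linForm hD]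
    simp [pderiv_linForm, h, ha]

theorem diffHom_linForm_qdiv_succ (hD : ∀ i f, D (X i) f = pderiv i f) (a : Fin n → ℂ) (m : ℕ) :
    D (linForm a) (qdiv n (m + 1)) = linForm a * qdiv n m := by
  rw [diffHom_linForm hD, linForm, Finset.sum_mul]
  exact Finset.sum_congr rfl fun i _ => by rw [pderiv_qdiv_succ, smul_eq_C_mul, mul_assoc]

theorem diffHom_linForm_pow_qdiv (hD : ∀ i f, D (X i) f = pderiv i f) {a : Fin n → ℂ}
    (ha : dotC a a = 0) (k m : ℕ) :
    D (linForm a ^ k) (qdiv n (m + k)) = linForm a ^ k * qdiv n m := by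
  induction k generalizing m with
  | zero => simp
  | succ k ih =>
    rw [pow_succ', map_mul, Module.End.mul_apply, ← add_assoc, add_right_comm, ih,
      diffHom_linForm_mul hD, diffHom_linForm_linForm_pow hD ha, diffHom_linForm_qdiv_succ hD]
    ring

theorem eq_zero_of_diffHom_sub_eq_zero (hD : ∀ i f, D (X i) f = pderiv i f) {s : ℕ} (hs : 1 ≤ s)
    {a : Fin n → ℂ} (ha : dotC a a = 0) {φ : MvPolynomial (Fin n) ℂ} (hφ : φ.IsHomogeneous s)
    (h : D φ (qdiv n s - linDiv a (2 * s)) = 0) : φ = 0 := by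
  rw [map_sub, two_mul, diffHom_linDiv hD a hφ, sub_eq_zero] at h
  have hpow : D (linForm a ^ s) (qdiv n s) = linForm a ^ s := by
    have := diffHom_linForm_pow_qdiv hD ha s 0
    rwa [zero_add, show qdiv n 0 = 1 by simp [qdiv], mul_one] at this
  have hL : (linForm a ^ s).IsHomogeneous s := by
    simpa using (isHomogeneous_linForm a).pow s
  have hlin : (linDiv a s).IsHomogeneous s :=
    (homogeneousSubmodule (Fin n) ℂ s).smul_mem _ hL
  have hψ : (φ - eval a φ • linDiv a s).IsHomogeneous s :=
    hφ.sub ((homogeneousSubmodule (Fin n) ℂ s).smul_mem _ hlin)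
  have h0 : φ - eval a φ • linDiv a s = 0 := by
    refine eq_zero_of_diffHom_qdiv_eq_zero hD hψ ?_
    rw [map_sub, LinearMap.sub_apply, h, map_smul, LinearMap.smul_apply, sub_eq_zero]
    congr 1
    rw [linDiv, map_smul, LinearMap.smul_apply, hpow]
  have heval : eval a φ = 0 := by
    have h1 := congrArg (eval a) (sub_eq_zero.mp h0)
    rw [h1, smul_eval, linDiv, smul_eval, map_pow, eval_linForm, ha, zero_pow (by omega)]
    simp
  rw [heval, zero_smul, sub_zero] at h0
  exact h0

end

theorem finrank_homogeneousSubmodule (n s : ℕ) :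
    Module.finrank ℂ (homogeneousSubmodule (Fin n) ℂ s) = (s + n - 1).choose s := by
  classical
  let T : Set (Fin n →₀ ℕ) := {d | d.degree = s}
  have e : T ≃ Sym (Fin n) s :=
    (Equiv.subtypeEquivRight fun _ => Iff.rfl).trans (Sym.equivNatSum (Fin n) s).symm
  let _ : Fintype T := Fintype.ofEquiv _ e.symm
  rw [homogeneousSubmodule_eq_finsupp_supported,
    (AddMonoidAlgebra.supportedEquivFinsupp (R := ℂ) (S := ℂ) T).finrank_eq,
    Module.finrank_finsupp_self, Fintype.card_congr e, Sym.card_sym_eq_choose, Fintype.card_fin,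
    add_comm]

/-- For an isotropic point a and f = q_n^{[s]} − (a·x)^{[2s]}, the middle
catalecticant Cat_{f,s} is injective, i.e. it has full rank T_{n,s} = binom(s+n−1, s). -/
theorem middle_catalecticant_injective_of_isotropic (n s : ℕ) (hn : 1 ≤ n) (hs : 1 ≤ s)
    (a : Fin n → ℂ) (ha : dotC a a = 0) (f : MvPolynomial (Fin n) ℂ)
    (hf : f = ((2 : ℂ) ^ s * (Nat.factorial s : ℂ))⁻¹ • qpoly n ^ s -
        ((Nat.factorial (2 * s) : ℂ))⁻¹ • linForm a ^ (2 * s)) :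
    Set.InjOn (fun φ => diffOp φ f) {φ : MvPolynomial (Fin n) ℂ | φ.IsHomogeneous s} ∧
      catRank n s f = (s + n - 1).choose s := by
  obtain ⟨D, hD, hdiff⟩ := exists_diffHom n
  let F : MvPolynomial (Fin n) ℂ →ₗ[ℂ] MvPolynomial (Fin n) ℂ := D.toLinearMap.flip f
  have hF : (fun φ => diffOp φ f) = F := funext fun φ => hdiff φ f
  have hker : ∀ φ : MvPolynomial (Fin n) ℂ, φ.IsHomogeneous s → F φ = 0 → φ = 0 := by
    intro φ hφ h
    refine eq_zero_of_diffHom_sub_eq_zero hD hs ha hφ ?_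
    rw [qdiv, linDiv, ← hf]
    exact h
  have hset : {φ : MvPolynomial (Fin n) ℂ | φ.IsHomogeneous s} =
      (homogeneousSubmodule (Fin n) ℂ s : Set (MvPolynomial (Fin n) ℂ)) := rfl
  have hinj : Set.InjOn F {φ : MvPolynomial (Fin n) ℂ | φ.IsHomogeneous s} := by
    intro φ hφ ψ hψ h
    refine sub_eq_zero.mp (hker _ (IsHomogeneous.sub hφ hψ) ?_)
    rw [map_sub, h, sub_self]
  refine ⟨hF ▸ hinj, ?_⟩
  rw [catRank, hF, hset, ← Submodule.map_coe, Submodule.span_eq,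
    ← finrank_homogeneousSubmodule n s]
  have hinj' : Function.Injective (F.domRestrict (homogeneousSubmodule (Fin n) ℂ s)) := by
    intro x y h
    exact Subtype.ext (hinj x.2 y.2 h)
  rw [← LinearMap.finrank_range_of_inj hinj', LinearMap.range_domRestrict]
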